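/- arXiv:2008.12988 — 6 statements merged into one kernel-verified Lean document; each statement's English description precedes it below -/
import Mathlib

section
/- Single-root Matrix–Tree Theorem (Koo et al., Prop. 1): for every weight function w : E → ℝ, the sum of w(d) over all spanning arborescences d in which the root ρ has exactly one outgoing edge equals the determinant of the root-weighted Laplacian L̂(w). -/
open scoped Classical
open Finset

/-- Nodes: `{0, 1, …, N}` with root `0`. -/
abbrev V (N : ℕ) := Fin (N + 1)

/-- Directed edges as ordered pairs of nodes. -/
abbrev Edge (N : ℕ) := V N × V N

/-- `(i, j)` is an edge iff `j` is not the root and `i ≠ j`. -/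
def IsEdge (N : ℕ) (e : Edge N) : Prop := e.2 ≠ 0 ∧ e.1 ≠ e.2

/-- The finite set `E` of all edges. -/
noncomputable def Efin (N : ℕ) : Finset (Edge N) :=
  Finset.univ.filter (IsEdge N)

/-- A spanning arborescence: a set of edges in which every non-root node has exactly
one incoming edge, and every non-root node is reachable from the root (equivalently,
there are no directed cycles). -/
def IsArbo (N : ℕ) (d : Finset (Edge N)) : Prop :=
  (∀ e ∈ d, IsEdge N e) ∧
  (∀ j : V N, j ≠ 0 → ∃! i : V N, (i, j) ∈ d) ∧
  (∀ j : V N, j ≠ 0 → Relation.ReflTransGen (fun a b : V N => (a, b) ∈ d) 0 j)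

/-- The finite set `D` of all spanning arborescences. -/
noncomputable def D (N : ℕ) : Finset (Finset (Edge N)) :=
  Finset.univ.filter (IsArbo N)

/-- The weight of a tree: product of its edge weights. -/
noncomputable def wt (N : ℕ) (w : Edge N → ℝ) (d : Finset (Edge N)) : ℝ :=
  ∏ e ∈ d, w e

/-- The partition function `Z`. -/
noncomputable def Z (N : ℕ) (w : Edge N → ℝ) : ℝ :=
  ∑ d ∈ D N, wt N w d

/-- Total weight of arborescences containing the edge `e`. -/
noncomputable def wbar (N : ℕ) (w : Edge N → ℝ) (e : Edge N) : ℝ :=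
  ∑ d ∈ (D N).filter (fun d => e ∈ d), wt N w d

/-- The Laplacian matrix, indexed by the non-root nodes `{1, …, N}`
(index `k : Fin N` stands for the node `k.succ`). -/
noncomputable def Lap (N : ℕ) (w : Edge N → ℝ) : Matrix (Fin N) (Fin N) ℝ :=
  Matrix.of fun i j =>
    if i = j then ∑ i' : V N, (if i' ≠ j.succ then w (i', j.succ) else 0)
    else - w (i.succ, j.succ)

/-- The set of single-rooted spanning arborescences: those in which the root has
exactly one outgoing edge. -/
noncomputable def D1 (N : ℕ) : Finset (Finset (Edge N)) :=
  (D N).filter (fun d => ∃! e : Edge N, e ∈ d ∧ e.1 = 0)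

/-- The root-weighted Laplacian of Koo et al. (2007), indexed by the non-root nodes
`{1, …, N}` (index `k : Fin N` stands for the node `k.succ`):
its first row holds the root-edge weights. -/
noncomputable def LapHat (N : ℕ) (w : Edge N → ℝ) : Matrix (Fin N) (Fin N) ℝ :=
  Matrix.of fun i j =>
    if (i : ℕ) = 0 then w (0, j.succ)
    else if i = j then ∑ i' : V N, (if i' ≠ 0 ∧ i' ≠ j.succ then w (i', j.succ) else 0)
    else - w (i.succ, j.succ)

/-- Extend a parent assignment `p` on the non-root nodes to all nodes, fixing the root. -/
def parentMap {N : ℕ} (p : Fin N → V N) : V N → V N := Fin.cons 0 p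

/-- Every node reaches the root by iterating the parent map. -/
def ReachesRoot {N : ℕ} (p : Fin N → V N) : Prop :=
  ∀ v : V N, ∃ k : ℕ, (parentMap p)^[k] v = 0

/-- The edge set of a parent assignment. -/
def parentEdges {N : ℕ} (p : Fin N → V N) : Finset (Edge N) :=
  Finset.univ.image fun j : Fin N => (p j, j.succ)

/-- The matrix of a parent assignment, viewed as a partial map on the non-root nodes. -/
def parentMatrix {N : ℕ} (p : Fin N → V N) : Matrix (Fin N) (Fin N) ℝ :=
  Matrix.of fun i j => if p j = i.succ then 1 else 0

/-- The contribution of the edge `(v, j.succ)` to the `j`-th column of `LapHat`. -/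
def lapHatColumn {N : ℕ} (j : Fin N) (v : V N) (i : Fin N) : ℝ :=
  if (i : ℕ) = 0 then (if v = 0 then 1 else 0)
  else (if i = j ∧ v ≠ 0 then 1 else 0) - (if v = i.succ then 1 else 0)

@[simp]
lemma parentMap_zero {N : ℕ} (p : Fin N → V N) : parentMap p 0 = 0 := rfl

@[simp]
lemma parentMap_succ {N : ℕ} (p : Fin N → V N) (j : Fin N) : parentMap p j.succ = p j := rfl

@[simp]
lemma iterate_parentMap_zero {N : ℕ} (p : Fin N → V N) (k : ℕ) :
    (parentMap p)^[k] 0 = 0 :=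
  Function.iterate_fixed (parentMap_zero p) k

lemma parentMatrix_apply {N : ℕ} (p : Fin N → V N) (i j : Fin N) :
    parentMatrix p i j = if p j = i.succ then 1 else 0 := rfl

lemma parentMatrix_pow_apply {N : ℕ} (p : Fin N → V N) (k : ℕ) (i j : Fin N) :
    (parentMatrix p ^ k) i j = if (parentMap p)^[k] j.succ = i.succ then 1 else 0 := by
  induction k generalizing j with
  | zero => simp [Matrix.one_apply, eq_comm]
  | succ k ih =>
    rw [pow_succ, Matrix.mul_apply, Function.iterate_succ_apply, parentMap_succ]
    simp only [ih, parentMatrix_apply]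
    cases p j using Fin.cases with
    | zero => simp [(Fin.succ_ne_zero _).symm]
    | succ m => simp

lemma isNilpotent_parentMatrix {N : ℕ} {p : Fin N → V N} (hp : ReachesRoot p) :
    IsNilpotent (parentMatrix p) := by
  choose k hk using hp
  refine ⟨∑ v, k v, ?_⟩
  ext i j
  have hle : k j.succ ≤ ∑ v, k v :=
    Finset.single_le_sum (fun _ _ => Nat.zero_le _) (Finset.mem_univ j.succ)
  obtain ⟨m, hm⟩ := Nat.exists_eq_add_of_le' hle
  rw [parentMatrix_pow_apply, hm, Function.iterate_add_apply, hk, iterate_parentMap_zero]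
  simp [(Fin.succ_ne_zero _).symm]

lemma det_one_sub_of_isNilpotent {n R : Type*} [Fintype n] [DecidableEq n] [CommRing R]
    [IsDomain R] {M : Matrix n n R} (hM : IsNilpotent M) : (1 - M).det = 1 := by
  have h := (Matrix.isNilpotent_charpoly_sub_pow_of_isNilpotent hM).eq_zero
  have h1 := Matrix.eval_charpoly M 1
  rw [sub_eq_zero.mp h] at h1
  simpa using h1.symm

lemma det_one_sub_parentMatrix_of_not_reachesRoot {N : ℕ} {p : Fin N → V N}
    (hp : ¬ ReachesRoot p) : (1 - parentMatrix p).det = 0 := by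
  simp only [ReachesRoot, not_forall] at hp
  obtain ⟨v, hv⟩ := hp
  let u : V N → ℝ := fun v => if ∃ k : ℕ, (parentMap p)^[k] v = 0 then 0 else 1
  have u_zero : u 0 = 0 := if_pos ⟨0, rfl⟩
  have u_parent (j : Fin N) : u (p j) = u j.succ := by
    have h : (∃ k : ℕ, (parentMap p)^[k] (p j) = 0) ↔
        ∃ k : ℕ, (parentMap p)^[k] j.succ = 0 := by
      constructor
      · rintro ⟨k, hk⟩
        exact ⟨k + 1, by simpa using hk⟩
      · rintro ⟨k, hk⟩
        refine ⟨k, ?_⟩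
        rw [← parentMap_succ p j, ← Function.iterate_succ_apply, Function.iterate_succ_apply', hk,
          parentMap_zero]
    simp only [u, h]
  rw [← Matrix.exists_vecMul_eq_zero_iff]
  refine ⟨fun i => u i.succ, fun h => ?_, ?_⟩
  · cases v using Fin.cases with
    | zero => exact hv ⟨0, rfl⟩
    | succ j =>
      have hj := congrFun h j
      simp [u, hv] at hj
  · ext j
    rw [Matrix.vecMul_sub, Matrix.vecMul_one, Pi.sub_apply, Pi.zero_apply, sub_eq_zero,
      ← u_parent j]
    simp only [Matrix.vecMul, dotProduct, parentMatrix_apply]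
    cases p j using Fin.cases with
    | zero => simp [u_zero, (Fin.succ_ne_zero _).symm]
    | succ m => simp

lemma det_one_sub_parentMatrix {N : ℕ} (p : Fin N → V N) :
    (1 - parentMatrix p).det = if ReachesRoot p then 1 else 0 := by
  split_ifs with hp
  · exact det_one_sub_of_isNilpotent (isNilpotent_parentMatrix hp)
  · exact det_one_sub_parentMatrix_of_not_reachesRoot hp

lemma det_lapHatColumn_of_existsUnique {n : ℕ} {p : Fin (n + 1) → V (n + 1)}
    (hp : ∃! j, p j = 0) :
    (Matrix.of fun i j => lapHatColumn j (p j) i).det = (1 - parentMatrix p).det := by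
  have hsum := Matrix.det_updateRow_sum (1 - parentMatrix p) 0 (fun _ => 1)
  rw [one_smul] at hsum
  rw [← hsum, Matrix.det_succ_row_zero, Matrix.det_succ_row_zero]
  refine Finset.sum_congr rfl fun j _ => ?_
  have hrow : (∑ i, (1 : ℝ) • (1 - parentMatrix p) i) j = if p j = 0 then 1 else 0 := by
    refine (Finset.sum_apply j _ _).trans ?_
    simp only [Pi.smul_apply, one_smul, Matrix.sub_apply, Finset.sum_sub_distrib,
      Matrix.one_apply, parentMatrix_apply]
    cases p j using Fin.cases with
    | zero => simp [(Fin.succ_ne_zero _).symm]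
    | succ m => simp
  rw [Matrix.updateRow_self, hrow]
  by_cases hj : p j = 0
  · congr 2
    ext i k
    have hk : p (j.succAbove k) ≠ 0 := fun h => Fin.succAbove_ne j k (hp.unique h hj)
    simp [lapHatColumn, parentMatrix_apply, Matrix.one_apply, hk]
  · simp [lapHatColumn, hj]

lemma det_lapHatColumn {n : ℕ} (p : Fin (n + 1) → V (n + 1)) :
    (Matrix.of fun i j => lapHatColumn j (p j) i).det =
      if ReachesRoot p ∧ ∃! j, p j = 0 then 1 else 0 := by
  by_cases hp : ∃! j, p j = 0
  · simp [det_lapHatColumn_of_existsUnique hp, det_one_sub_parentMatrix, hp]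
  · rw [if_neg fun h => hp h.2]
    by_cases hex : ∃ j, p j = 0
    · obtain ⟨j, hj⟩ := hex
      obtain ⟨k, hk, hkj⟩ : ∃ k, p k = 0 ∧ k ≠ j := by
        by_contra! h
        exact hp ⟨j, hj, h⟩
      refine Matrix.det_zero_of_column_eq hkj fun i => ?_
      simp [lapHatColumn, hj, hk, (Fin.succ_ne_zero _).symm]
    · push Not at hex
      exact Matrix.det_eq_zero_of_row_eq_zero 0 fun j => by simp [lapHatColumn, hex]

lemma LapHat_apply_eq_sum {N : ℕ} (w : Edge N → ℝ) (i j : Fin N) :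
    LapHat N w i j = ∑ v : V N, w (v, j.succ) * lapHatColumn j v i := by
  simp only [LapHat, lapHatColumn, Matrix.of_apply]
  split_ifs with h0 hij
  · simp
  · subst hij
    refine Finset.sum_congr rfl fun v _ => ?_
    by_cases hv : v = 0 <;> by_cases hvi : v = i.succ <;>
      simp_all [(Fin.succ_ne_zero _).symm]
  · simp [hij]

lemma det_LapHat_eq_sum {N : ℕ} (w : Edge N → ℝ) :
    (LapHat N w).det = ∑ p : Fin N → V N,
      (∏ j, w (p j, j.succ)) * (Matrix.of fun i j => lapHatColumn j (p j) i).det := by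
  have hT : (LapHat N w).transpose =
      fun j => ∑ v : V N, w (v, j.succ) • lapHatColumn j v := by
    ext j i
    simp [LapHat_apply_eq_sum]
  rw [← Matrix.det_transpose, hT]
  refine (Matrix.detRowAlternating.toMultilinearMap.map_sum
    (fun (j : Fin N) (v : V N) => w (v, j.succ) • lapHatColumn j v)).trans ?_
  refine Finset.sum_congr rfl fun p _ => ?_
  refine (Matrix.detRowAlternating.toMultilinearMap.map_smul_univ
    (fun j : Fin N => w (p j, j.succ)) (fun j => lapHatColumn j (p j))).trans ?_
  rw [smul_eq_mul, ← Matrix.det_transpose (Matrix.of _)]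
  rfl

lemma mem_parentEdges {N : ℕ} {p : Fin N → V N} {a b : V N} :
    (a, b) ∈ parentEdges p ↔ b ≠ 0 ∧ a = parentMap p b := by
  cases b using Fin.cases with
  | zero => simp [parentEdges]
  | succ j => simp [parentEdges, eq_comm]

lemma mem_parentEdges_succ {N : ℕ} {p : Fin N → V N} {a : V N} {j : Fin N} :
    (a, j.succ) ∈ parentEdges p ↔ a = p j := by
  simp [mem_parentEdges]

lemma parentEdges_injective {N : ℕ} : Function.Injective (parentEdges (N := N)) := by
  intro p q h
  ext1 j
  exact mem_parentEdges_succ.mp (h ▸ mem_parentEdges_succ.mpr rfl)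

lemma wt_parentEdges {N : ℕ} (w : Edge N → ℝ) (p : Fin N → V N) :
    wt N w (parentEdges p) = ∏ j, w (p j, j.succ) := by
  rw [wt, parentEdges, Finset.prod_image]
  intro i _ j _ h
  exact Fin.succ_injective _ (Prod.mk.inj h).2

lemma reachesRoot_iff_reflTransGen {N : ℕ} {p : Fin N → V N} :
    ReachesRoot p ↔
      ∀ j : V N, j ≠ 0 → Relation.ReflTransGen (fun a b => (a, b) ∈ parentEdges p) 0 j := by
  constructor
  · intro hp v _
    obtain ⟨k, hk⟩ := hp v
    induction k generalizing v with
    | zero => exact hk ▸ .refl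
    | succ k ih =>
      by_cases hv : v = 0
      · exact hv ▸ .refl
      · rw [Function.iterate_succ_apply] at hk
        by_cases hpv : parentMap p v = 0
        · exact .single (mem_parentEdges.mpr ⟨hv, hpv.symm⟩)
        · exact (ih _ hpv hk).tail (mem_parentEdges.mpr ⟨hv, rfl⟩)
  · intro h v
    by_cases hv : v = 0
    · exact ⟨0, hv⟩
    · induction h v hv with
      | refl => exact ⟨0, rfl⟩
      | @tail b c _ hbc ih =>
        obtain ⟨-, rfl⟩ := mem_parentEdges.mp hbc
        by_cases hb : parentMap p c = 0
        · exact ⟨1, hb⟩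
        · obtain ⟨k, hk⟩ := ih hb
          exact ⟨k + 1, hk⟩

lemma ReachesRoot.ne_succ {N : ℕ} {p : Fin N → V N} (hp : ReachesRoot p) (j : Fin N) :
    p j ≠ j.succ := by
  intro h
  obtain ⟨k, hk⟩ := hp j.succ
  rw [Function.iterate_fixed ((parentMap_succ p j).trans h) k] at hk
  exact Fin.succ_ne_zero j hk

lemma isArbo_parentEdges_iff {N : ℕ} {p : Fin N → V N} :
    IsArbo N (parentEdges p) ↔ ReachesRoot p := by
  refine ⟨fun h => reachesRoot_iff_reflTransGen.mpr h.2.2, fun hp => ⟨?_, ?_,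
    reachesRoot_iff_reflTransGen.mp hp⟩⟩
  · simp only [parentEdges, Finset.mem_image, Finset.mem_univ, true_and, forall_exists_index]
    rintro _ j rfl
    exact ⟨Fin.succ_ne_zero j, hp.ne_succ j⟩
  · intro j hj
    exact ⟨parentMap p j, mem_parentEdges.mpr ⟨hj, rfl⟩, fun i hi => (mem_parentEdges.mp hi).2⟩

lemma IsArbo.exists_parentEdges_eq {N : ℕ} {d : Finset (Edge N)} (hd : IsArbo N d) :
    ∃ p : Fin N → V N, parentEdges p = d := by
  choose p hp hunique using fun j : Fin N => hd.2.1 j.succ (Fin.succ_ne_zero j)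
  refine ⟨p, ?_⟩
  ext ⟨a, b⟩
  cases b using Fin.cases with
  | zero => exact iff_of_false (by simp [mem_parentEdges]) fun h => (hd.1 _ h).1 rfl
  | succ j =>
    rw [mem_parentEdges_succ]
    exact ⟨fun h => h ▸ hp j, hunique j a⟩

lemma existsUnique_root_edge_iff {N : ℕ} {p : Fin N → V N} :
    (∃! e : Edge N, e ∈ parentEdges p ∧ e.1 = 0) ↔ ∃! j, p j = 0 := by
  constructor
  · rintro ⟨⟨a, b⟩, ⟨he, rfl : a = 0⟩, hunique⟩
    cases b using Fin.cases with
    | zero => simp [mem_parentEdges] at he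
    | succ j =>
      refine ⟨j, (mem_parentEdges_succ.mp he).symm, fun k hk => ?_⟩
      have := hunique (0, k.succ) ⟨mem_parentEdges_succ.mpr hk.symm, rfl⟩
      exact Fin.succ_injective _ (Prod.mk.inj this).2
  · rintro ⟨j, hj, hunique⟩
    refine ⟨(0, j.succ), ⟨mem_parentEdges_succ.mpr hj.symm, rfl⟩, ?_⟩
    rintro ⟨a, b⟩ ⟨he, rfl : a = 0⟩
    cases b using Fin.cases with
    | zero => simp [mem_parentEdges] at he
    | succ k => rw [hunique k (mem_parentEdges_succ.mp he).symm]

lemma D1_eq_image {N : ℕ} :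
    D1 N = (Finset.univ.filter fun p : Fin N → V N => ReachesRoot p ∧ ∃! j, p j = 0).image
      parentEdges := by
  ext d
  simp only [D1, D, Finset.mem_filter, Finset.mem_univ, true_and, Finset.mem_image]
  constructor
  · rintro ⟨hd, hroot⟩
    obtain ⟨p, rfl⟩ := hd.exists_parentEdges_eq
    exact ⟨p, ⟨isArbo_parentEdges_iff.mp hd, existsUnique_root_edge_iff.mp hroot⟩, rfl⟩
  · rintro ⟨p, ⟨hp, hroot⟩, rfl⟩
    exact ⟨isArbo_parentEdges_iff.mpr hp, existsUnique_root_edge_iff.mpr hroot⟩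

/-- **Single-root Matrix–Tree Theorem** (Koo et al., Prop. 1): the sum of tree weights
over all single-rooted spanning arborescences equals the determinant of the
root-weighted Laplacian. -/
theorem single_root_matrix_tree_theorem (N : ℕ) (hN : 1 ≤ N) (w : Edge N → ℝ) :
    ∑ d ∈ D1 N, wt N w d = (LapHat N w).det := by
  obtain ⟨n, rfl⟩ := Nat.exists_eq_add_of_le' hN
  rw [D1_eq_image, Finset.sum_image parentEdges_injective.injOn, det_LapHat_eq_sum,
    Finset.sum_filter]
  refine Finset.sum_congr rfl fun p _ => ?_
  rw [det_lapHatColumn, wt_parentEdges, mul_ite, mul_one, mul_zero]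
end

section
/- Derivative of the first-order total (Prop. 4.4): let r_{ij} ∈ ℝ^R be fixed vectors (not depending on w) indexed by edges. For every weight function w : E → ℝ and every edge (i,j) ∈ E, w_{ij} · (∂r̄/∂w_{ij})(w) = w̄_{ij}(w) r_{ij} + Σ_{(k,l)∈E, (k,l)≠(i,j)} w̄_{ij,kl}(w) r_{kl}. -/
open scoped Classical
open Finset

/-- Total weight of arborescences containing both edges `e` and `e'`. -/
noncomputable def wbar2 (N : ℕ) (w : Edge N → ℝ) (e e' : Edge N) : ℝ :=
  ∑ d ∈ (D N).filter (fun d => e ∈ d ∧ e' ∈ d), wt N w d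

/-- The total `r̄(w) = Σ_d w(d) r(d)` of the additively decomposable function
`r(d) = Σ_{e∈d} r_e` for fixed edge vectors `r_e ∈ ℝ^R`. -/
noncomputable def rbar (N R : ℕ) (r : Edge N → Fin R → ℝ) (w : Edge N → ℝ) :
    Fin R → ℝ :=
  ∑ d ∈ D N, wt N w d • ∑ e ∈ d, r e

/-- The derivative of the weight of `d` along the coordinate `e`, scaled by `w e`, is the weight
of `d` if `e ∈ d` and zero otherwise. -/
theorem mul_fderiv_wt_single (N : ℕ) (w : Edge N → ℝ) (d : Finset (Edge N)) (e : Edge N) :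
    w e * fderiv ℝ (fun w => wt N w d) w (Pi.single e 1) = if e ∈ d then wt N w d else 0 := by
  have h : HasFDerivAt (fun w => wt N w d)
      (∑ i ∈ d, (∏ j ∈ d.erase i, w j) • ContinuousLinearMap.proj (R := ℝ) i) w :=
    hasFDerivAt_finsetProd
  rw [h.fderiv]
  simp only [_root_.sum_apply, _root_.smul_apply,
    ContinuousLinearMap.proj_apply, Pi.single_apply, smul_eq_mul, mul_ite, mul_one, mul_zero,
    Finset.sum_ite_eq']
  split_ifs with hed
  · exact Finset.mul_prod_erase d w hed
  · rfl

theorem differentiable_wt (N : ℕ) (d : Finset (Edge N)) :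
    Differentiable ℝ (fun w => wt N w d) := by
  unfold wt
  fun_prop

theorem wbar2_self (N : ℕ) (w : Edge N → ℝ) (e : Edge N) : wbar2 N w e e = wbar N w e := by
  simp [wbar2, wbar]

/-- Exchanging the sums over arborescences and over edges. -/
theorem sum_wbar2_smul (N R : ℕ) (r : Edge N → Fin R → ℝ) (w : Edge N → ℝ) (e : Edge N) :
    ∑ e' ∈ Efin N, wbar2 N w e e' • r e'
      = ∑ d ∈ D N, (if e ∈ d then wt N w d else 0) • ∑ e' ∈ d, r e' := by
  simp only [wbar2, Finset.sum_smul, Finset.sum_filter]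
  rw [Finset.sum_comm]
  refine Finset.sum_congr rfl fun d hd => ?_
  have hsub : d ⊆ Efin N := fun x hx => by
    simpa [Efin] using (Finset.mem_filter.mp hd).2.1 x hx
  by_cases hed : e ∈ d
  · simp only [hed, true_and, if_true, ite_smul, zero_smul, Finset.smul_sum]
    rw [Finset.sum_ite_mem, Finset.inter_eq_right.mpr hsub]
  · simp [hed]

/-- **Derivative of the first-order total** (Prop. 4.4): for fixed edge vectors
`r_e ∈ ℝ^R` (not depending on `w`) and any edge `e`,
`w_e · (∂r̄/∂w_e)(w) = w̄_e(w) r_e + Σ_{e'≠e} w̄_{e,e'}(w) r_{e'}`. -/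
theorem deriv_first_order_total (N : ℕ) (hN : 1 ≤ N) (R : ℕ) (r : Edge N → Fin R → ℝ)
    (w : Edge N → ℝ) (e : Edge N) (he : IsEdge N e) :
    w e • fderiv ℝ (rbar N R r) w (Pi.single e 1)
      = wbar N w e • r e + ∑ e' ∈ (Efin N).erase e, wbar2 N w e e' • r e' := by
  have hmem : e ∈ Efin N := by simpa [Efin] using he
  rw [← wbar2_self, Finset.add_sum_erase _ (fun e' => wbar2 N w e e' • r e') hmem, sum_wbar2_smul]
  have h : HasFDerivAt (rbar N R r)
      (∑ d ∈ D N, (fderiv ℝ (fun w => wt N w d) w).smulRight (∑ e' ∈ d, r e')) w :=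
    HasFDerivAt.fun_sum fun d _ =>
      (differentiable_wt N d w).hasFDerivAt.smul_const (∑ e' ∈ d, r e')
  rw [h.fderiv, _root_.sum_apply, Finset.smul_sum]
  refine Finset.sum_congr rfl fun d _ => ?_
  rw [ContinuousLinearMap.smulRight_apply, smul_smul, ← mul_fderiv_wt_single]
end

section
/- Second-order total via Jacobian–matrix product (Prop. 4.5, Eq. tbar-r): let r_{ij} ∈ ℝ^R and s_{ij} ∈ ℝ^S be fixed vectors indexed by edges, with r not depending on w, and let t(d) = r(d) s(d)^⊤ ∈ ℝ^{R×S}. Then for every weight function w : E → ℝ, the total t̄(w) = Σ_{d∈D} w(d) r(d) s(d)^⊤ satisfies t̄(w) = Σ_{(i,j)∈E} (∂r̄/∂w_{ij})(w) · w_{ij} · s_{ij}^⊤. -/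
open scoped Classical
open Finset

/-- The Fréchet derivative of the weight of a tree. -/
theorem hasFDerivAt_wt (N : ℕ) (w : Edge N → ℝ) (d : Finset (Edge N)) :
    HasFDerivAt (fun w => wt N w d)
      (∑ e ∈ d, (∏ e' ∈ d.erase e, w e') •
        (ContinuousLinearMap.proj e : (Edge N → ℝ) →L[ℝ] ℝ)) w :=
  HasFDerivAt.finsetProd fun e _ => hasFDerivAt_apply e w

/-- Euler's relation for a single edge: `w_e · ∂r̄/∂w_e` is the part of `r̄` carried by the
trees containing `e`. -/
theorem smul_fderiv_rbar_single (N R : ℕ) (r : Edge N → Fin R → ℝ) (w : Edge N → ℝ)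
    (e : Edge N) :
    w e • fderiv ℝ (rbar N R r) w (Pi.single e 1)
      = ∑ d ∈ D N, if e ∈ d then wt N w d • ∑ e' ∈ d, r e' else 0 := by
  have h : HasFDerivAt (rbar N R r) _ w :=
    HasFDerivAt.fun_sum fun d (_ : d ∈ D N) =>
      (hasFDerivAt_wt N w d).smul_const (∑ e' ∈ d, r e')
  rw [h.fderiv, _root_.sum_apply, Finset.smul_sum]
  refine Finset.sum_congr rfl fun d _ => ?_
  simp only [ContinuousLinearMap.smulRight_apply, _root_.sum_apply,
    _root_.smul_apply, ContinuousLinearMap.proj_apply, Pi.single_apply,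
    smul_eq_mul, mul_ite, mul_one, mul_zero, Finset.sum_ite_eq']
  split_ifs with he
  · rw [smul_smul, Finset.mul_prod_erase d w he, wt]
  · simp

/-- An arborescence consists of edges. -/
theorem subset_Efin_of_mem_D {N : ℕ} {d : Finset (Edge N)} (hd : d ∈ D N) : d ⊆ Efin N :=
  fun e he => Finset.mem_filter.2 ⟨Finset.mem_univ e, (Finset.mem_filter.1 hd).2.1 e he⟩

/-- **Second-order total via Jacobian–matrix product** (Prop. 4.5, Eq. tbar-r): for
fixed edge vectors `r_e ∈ ℝ^R` and `s_e ∈ ℝ^S`, the total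
`t̄(w) = Σ_d w(d) r(d) s(d)^⊤` equals `Σ_{e∈E} (∂r̄/∂w_e)(w) · w_e · s_e^⊤`. -/
theorem second_order_total_jacobian (N : ℕ) (hN : 1 ≤ N) (R S : ℕ)
    (r : Edge N → Fin R → ℝ) (s : Edge N → Fin S → ℝ) (w : Edge N → ℝ) :
    (∑ d ∈ D N, wt N w d • Matrix.vecMulVec (∑ e ∈ d, r e) (∑ e ∈ d, s e))
      = ∑ e ∈ Efin N,
          w e • Matrix.vecMulVec (fderiv ℝ (rbar N R r) w (Pi.single e 1)) (s e) := by
  simp_rw [← Matrix.smul_vecMulVec, smul_fderiv_rbar_single]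
  ext a b
  simp only [Matrix.sum_apply, Matrix.vecMulVec_apply, Finset.sum_apply, Finset.sum_mul]
  rw [Finset.sum_comm]
  refine Finset.sum_congr rfl fun d hd => ?_
  rw [Finset.mul_sum, ← Finset.sum_subset (subset_Efin_of_mem_D hd)]
  · exact Finset.sum_congr rfl fun e he => by simp [he]
  · exact fun e _ he => by simp [he]
end

section
/- Second derivative of the determinant (Eq. dzdl): let A be an invertible n×n real matrix and let B = (A^{-1})^⊤. Then for all indices a, b, c, d, the second partial derivative of the determinant, viewed as a polynomial function of the n² matrix entries, evaluated at A satisfies ∂²det/∂A_{ab}∂A_{cd} = det(A) · (B_{ab} B_{cd} − B_{ad} B_{cb}). -/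
open Matrix

namespace Matrix

variable {m : Type*} [Fintype m] [DecidableEq m]

theorem differentiable_det_comp {E : Type*} [NormedAddCommGroup E] [NormedSpace ℝ E]
    {M : E → Matrix m m ℝ} (hM : ∀ i j, Differentiable ℝ fun x => M x i j) :
    Differentiable ℝ fun x => (M x).det := by
  simp only [det_apply']
  fun_prop

theorem differentiable_adjugate_comp {E : Type*} [NormedAddCommGroup E] [NormedSpace ℝ E]
    {M : E → Matrix m m ℝ} (hM : ∀ i j, Differentiable ℝ fun x => M x i j) (i j : m) :
    Differentiable ℝ fun x => (M x).adjugate i j := by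
  simp only [adjugate_apply]
  refine differentiable_det_comp fun k l => ?_
  by_cases hk : k = j
  · subst hk
    simp
  · simpa [updateRow_ne hk] using hM k l

theorem det_add_smul_single {R : Type*} [CommRing R] (A : Matrix m m R) (i j : m) (t : R) :
    (A + t • single i j 1).det = A.det + t * A.adjugate j i := by
  have h : A + t • single i j 1 = A.updateRow i (A i + t • Pi.single j 1) := by
    ext k l
    by_cases hk : k = i
    · subst hk
      simp [single_apply, Pi.single_apply, eq_comm]
    · simp [updateRow_ne hk, Ne.symm hk]
  rw [h, det_updateRow_add, det_updateRow_smul, updateRow_eq_self, adjugate_apply]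

theorem fderiv_det_apply_single (X : m × m → ℝ) (c d : m) :
    fderiv ℝ (fun Y : m × m → ℝ => det (of fun i j => Y (i, j))) X (Pi.single (c, d) 1)
      = (of fun i j => X (i, j)).adjugate d c := by
  have hdiff : Differentiable ℝ fun Y : m × m → ℝ => det (of fun i j => Y (i, j)) :=
    differentiable_det_comp fun i j => by simp only [of_apply]; fun_prop
  rw [← (hdiff X).lineDeriv_eq_fderiv, lineDeriv]
  have h (t : ℝ) : (of fun i j => (X + t • Pi.single (c, d) 1 : m × m → ℝ) (i, j) : Matrix m m ℝ)
      = (of fun i j => X (i, j)) + t • single c d 1 := by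
    ext i j
    simp [single_apply, Pi.single_apply, eq_comm]
  simp only [h, det_add_smul_single]
  simp

/-- Obtained by differentiating `adjugate X * X = det X • 1`. -/
theorem fderiv_adjugate_apply_single (X : m × m → ℝ)
    (hX : IsUnit (of fun i j => X (i, j) : Matrix m m ℝ).det) (a b c d : m) :
    fderiv ℝ (fun Y : m × m → ℝ => (of fun i j => Y (i, j) : Matrix m m ℝ).adjugate d c) X
        (Pi.single (a, b) 1)
      = (of fun i j => X (i, j) : Matrix m m ℝ).det *
        ((of fun i j => X (i, j) : Matrix m m ℝ)⁻¹ b a *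
            (of fun i j => X (i, j) : Matrix m m ℝ)⁻¹ d c
          - (of fun i j => X (i, j) : Matrix m m ℝ)⁻¹ d a *
            (of fun i j => X (i, j) : Matrix m m ℝ)⁻¹ b c) := by
  set A : Matrix m m ℝ := of fun i j => X (i, j) with hA
  set D : Matrix m m ℝ := of fun i k =>
    fderiv ℝ (fun Y : m × m → ℝ => (of fun i j => Y (i, j) : Matrix m m ℝ).adjugate i k) X
      (Pi.single (a, b) 1) with hD
  have hadj (i k : m) : Differentiable ℝ fun Y : m × m → ℝ =>
      (of fun i j => Y (i, j) : Matrix m m ℝ).adjugate i k :=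
    differentiable_adjugate_comp (fun i j => by simp only [of_apply]; fun_prop) i k
  have hdet : Differentiable ℝ fun Y : m × m → ℝ => det (of fun i j => Y (i, j)) :=
    differentiable_det_comp fun i j => by simp only [of_apply]; fun_prop
  have key : D * A + A.adjugate * single a b 1 = A.adjugate b a • (1 : Matrix m m ℝ) := by
    ext i j
    have hprod : (fun Y : m × m → ℝ =>
        ∑ k, (of fun i j => Y (i, j) : Matrix m m ℝ).adjugate i k * Y (k, j))
        = fun Y => det (of fun i j => Y (i, j)) * (1 : Matrix m m ℝ) i j := by
      funext Y
      have := congrFun₂ (adjugate_mul (of fun i j => Y (i, j) : Matrix m m ℝ)) i j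
      simpa [mul_apply] using this
    have hL : HasFDerivAt (fun Y : m × m → ℝ =>
        ∑ k, (of fun i j => Y (i, j) : Matrix m m ℝ).adjugate i k * Y (k, j)) _ X :=
      HasFDerivAt.fun_sum fun k _ =>
        ((hadj i k) X).hasFDerivAt.mul (hasFDerivAt_apply (𝕜 := ℝ) (k, j) X)
    rw [hprod] at hL
    have h := DFunLike.congr_fun
      (hL.unique ((hdet X).hasFDerivAt.mul_const ((1 : Matrix m m ℝ) i j))) (Pi.single (a, b) 1)
    simp only [_root_.sum_apply, _root_.add_apply,
      _root_.smul_apply, ContinuousLinearMap.proj_apply, smul_eq_mul,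
      fderiv_det_apply_single, Finset.sum_add_distrib, ← hA] at h
    simp only [add_apply, mul_apply, smul_apply, smul_eq_mul, hD, of_apply]
    rw [mul_comm (A.adjugate b a), ← h, add_comm]
    congr 1
    · simp [single_apply, Pi.single_apply, eq_comm]
    · simp [hA, mul_comm]
  have hadjugate : A.adjugate = A.det • A⁻¹ := by
    rw [inv_def, smul_smul, Ring.mul_inverse_cancel _ hX, one_smul]
  have hsolve : D = A.adjugate b a • A⁻¹ - A.adjugate * single a b 1 * A⁻¹ := by
    rw [← one_mul A⁻¹, ← smul_mul_assoc, ← key, one_mul, add_mul, add_sub_cancel_right,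
      mul_nonsing_inv_cancel_right _ _ hX]
  have hentry : (A⁻¹ * single a b 1 * A⁻¹ : Matrix m m ℝ) d c = A⁻¹ d a * A⁻¹ b c := by
    simp [mul_apply, single_apply, ite_and]
  change D d c = _
  rw [hsolve, hadjugate]
  simp only [sub_apply, smul_apply, smul_mul_assoc, hentry, smul_eq_mul]
  ring

end Matrix

/-- **Second derivative of the determinant** (Eq. dzdl): for an invertible `n×n` real
matrix `A` with `B = (A⁻¹)ᵀ`, the second partial derivative of the determinant (as a
polynomial function of the `n²` matrix entries) with respect to the entries `(a,b)` and
`(c,d)`, evaluated at `A`, is `det A · (B_{ab} B_{cd} − B_{ad} B_{cb})`. -/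
theorem det_second_partial_deriv (n : ℕ) (A : Matrix (Fin n) (Fin n) ℝ)
    (hA : IsUnit A.det) (a b c d : Fin n) :
    fderiv ℝ
        (fun X : Fin n × Fin n → ℝ =>
          fderiv ℝ (fun Y : Fin n × Fin n → ℝ => Matrix.det (Matrix.of fun i j => Y (i, j)))
            X (Pi.single (c, d) 1))
        (fun p => A p.1 p.2) (Pi.single (a, b) 1)
      = A.det * ((A⁻¹)ᵀ a b * (A⁻¹)ᵀ c d - (A⁻¹)ᵀ a d * (A⁻¹)ᵀ c b) := by
  simp only [fderiv_det_apply_single]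
  exact fderiv_adjugate_apply_single (fun p => A p.1 p.2) hA a b c d
end

section
/- Gradient of the partition function via the inverse Laplacian (Eq. dz with Eq. dlap): let w : E → ℝ be such that the Laplacian L(w) is invertible, and set Z(w) = det L(w) and B = (L(w)^{-1})^⊤. Then for every edge (i,j) ∈ E with i ≠ ρ, (∂Z/∂w_{ij})(w) = Z(w) · (B_{jj} − B_{ij}); and for every root edge (ρ,j) ∈ E, (∂Z/∂w_{ρj})(w) = Z(w) · B_{jj}. -/
open scoped Classical
open Finset

open Matrix

/-- The partition function as the determinant of the Laplacian. -/
noncomputable def Zdet (N : ℕ) (w : Edge N → ℝ) : ℝ := (Lap N w).det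

theorem differentiable_Zdet (N : ℕ) : Differentiable ℝ (Zdet N) := by
  have hent : ∀ i j, Differentiable ℝ fun w : Edge N → ℝ => Lap N w i j := by
    intro i j
    simp only [Lap, Matrix.of_apply]
    split_ifs
    · refine Differentiable.fun_sum fun i' _ => ?_
      split_ifs <;> fun_prop
    · fun_prop
  unfold Zdet
  simp only [Matrix.det_apply]
  fun_prop

/-- If moving `w` in direction `v` moves only column `j` of the Laplacian, in direction `u`, then
the derivative of the determinant along `v` is given by Cramer's rule. -/
theorem fderiv_Zdet_of_Lap_add_smul {N : ℕ} {w v : Edge N → ℝ} {j : Fin N} {u : Fin N → ℝ}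
    (hL : IsUnit (Lap N w).det)
    (h : ∀ t : ℝ, Lap N (w + t • v) = (Lap N w).updateCol j ((Lap N w)ᵀ j + t • u)) :
    fderiv ℝ (Zdet N) w v = Zdet N w * ((Lap N w)⁻¹ *ᵥ u) j := by
  have hcramer : (Lap N w).cramer u j = Zdet N w * ((Lap N w)⁻¹ *ᵥ u) j := by
    rw [Matrix.cramer_eq_adjugate_mulVec, Matrix.inv_def, Matrix.smul_mulVec, Pi.smul_apply,
      smul_eq_mul, ← mul_assoc, Zdet, Ring.mul_inverse_cancel _ hL, one_mul]
  have haffine : ∀ t : ℝ,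
      Zdet N (w + t • v) = Zdet N w + t * (Zdet N w * ((Lap N w)⁻¹ *ᵥ u) j) := by
    intro t
    rw [← hcramer, Matrix.cramer_apply, Zdet, h, Matrix.det_updateCol_add,
      Matrix.det_updateCol_smul, Zdet]
    congr 2
    exact Matrix.updateCol_eq_self _ _
  rw [← (differentiable_Zdet N w).lineDeriv_eq_fderiv, lineDeriv]
  simp only [haffine]
  simp

theorem Lap_add_smul_single_succ {N : ℕ} (w : Edge N → ℝ) {i j : Fin N} (hij : i ≠ j) (t : ℝ) :
    Lap N (w + t • Pi.single (i.succ, j.succ) 1) =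
      (Lap N w).updateCol j
        ((Lap N w)ᵀ j + t • (Pi.single j 1 - Pi.single i 1 : Fin N → ℝ)) := by
  ext a b
  by_cases hb : b = j
  · subst hb
    by_cases hab : a = b
    · subst hab
      have hsplit : ∀ x : V N,
          (if x ≠ a.succ then w (x, a.succ) + t * (if x = i.succ then 1 else 0) else 0) =
          (if x ≠ a.succ then w (x, a.succ) else 0) + (if x = i.succ then t else 0) := by
        intro x
        by_cases hx : x = i.succ
        · simp [hx, hij]
        · simp [hx]
      simp [Lap, Pi.single_apply, hij.symm] at hsplit ⊢
      simp [hsplit, Finset.sum_add_distrib]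
    · by_cases hai : a = i
      · simp [Lap, Pi.single_apply, hai, hij]
        ring
      · simp [Lap, Pi.single_apply, hab, hai]
  · simp [Lap, Pi.single_apply, hb]

theorem Lap_add_smul_single_zero {N : ℕ} (w : Edge N → ℝ) (j : Fin N) (t : ℝ) :
    Lap N (w + t • Pi.single ((0 : V N), j.succ) 1) =
      (Lap N w).updateCol j ((Lap N w)ᵀ j + t • (Pi.single j 1 : Fin N → ℝ)) := by
  ext a b
  by_cases hb : b = j
  · subst hb
    by_cases hab : a = b
    · subst hab
      have hsplit : ∀ x : V N,
          (if x ≠ a.succ then w (x, a.succ) + t * (if x = 0 then 1 else 0) else 0) =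
          (if x ≠ a.succ then w (x, a.succ) else 0) + (if x = 0 then t else 0) := by
        intro x
        by_cases hx : x = 0
        · simp [hx, (Fin.succ_ne_zero a).symm]
        · simp [hx]
      simp [Lap, Pi.single_apply] at hsplit ⊢
      simp [hsplit, Finset.sum_add_distrib]
    · simp [Lap, Pi.single_apply, hab]
  · simp [Lap, Pi.single_apply, hb]

/-- **Gradient of the partition function via the inverse Laplacian** (Eq. dz, dlap):
with `Z(w) = det L(w)` and `B = (L(w)⁻¹)ᵀ`, for a non-root edge `(i,j)` (here
represented by matrix indices `i j : Fin N`, standing for the nodes `i.succ, j.succ`),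
`∂Z/∂w_{ij} = Z(w)·(B_{jj} − B_{ij})`, and for a root edge `(ρ,j)`,
`∂Z/∂w_{ρj} = Z(w)·B_{jj}`. -/
theorem grad_Z_inverse_laplacian (N : ℕ) (hN : 1 ≤ N) (w : Edge N → ℝ)
    (hL : IsUnit (Lap N w).det) :
    (∀ i j : Fin N, i ≠ j →
       fderiv ℝ (Zdet N) w (Pi.single (i.succ, j.succ) 1)
         = Zdet N w * (((Lap N w)⁻¹)ᵀ j j - ((Lap N w)⁻¹)ᵀ i j)) ∧
    (∀ j : Fin N,
       fderiv ℝ (Zdet N) w (Pi.single ((0 : V N), j.succ) 1)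
         = Zdet N w * ((Lap N w)⁻¹)ᵀ j j) := by
  refine ⟨fun i j hij => ?_, fun j => ?_⟩
  · rw [fderiv_Zdet_of_Lap_add_smul hL (Lap_add_smul_single_succ w hij)]
    simp [Matrix.mulVec_sub]
  · rw [fderiv_Zdet_of_Lap_add_smul hL (Lap_add_smul_single_zero w j)]
    simp
end

section
/- Kullback–Leibler divergence between two arborescence distributions as a first-order expectation: if w_{ij} > 0 and q_{ij} > 0 for all edges (i,j) ∈ E and D is nonempty, then KL(p_w ∥ p_q) = Σ_{d∈D} p_w(d) log(p_w(d)/p_q(d)) = (1/Z(w)) Σ_{(i,j)∈E} w̄_{ij}(w) log(w_{ij}/q_{ij}) − log Z(w) + log Z(q). -/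
open scoped Classical
open Finset

lemma isEdge_of_mem_D {N : ℕ} {d : Finset (Edge N)} (hd : d ∈ D N) {e : Edge N} (he : e ∈ d) :
    IsEdge N e :=
  (Finset.mem_filter.mp hd).2.1 e he

lemma wt_pos {N : ℕ} {w : Edge N → ℝ} (hw : ∀ e, IsEdge N e → 0 < w e)
    {d : Finset (Edge N)} (hd : d ∈ D N) : 0 < wt N w d :=
  Finset.prod_pos fun e he => hw e (isEdge_of_mem_D hd he)

lemma Z_pos {N : ℕ} {w : Edge N → ℝ} (hw : ∀ e, IsEdge N e → 0 < w e)
    (hD : (D N).Nonempty) : 0 < Z N w :=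
  Finset.sum_pos (fun _ hd => wt_pos hw hd) hD

/-- Summing an additive edge functional against the arborescence weights only requires the
edge totals `wbar`. -/
lemma sum_wt_mul_sum (N : ℕ) (w f : Edge N → ℝ) :
    ∑ d ∈ D N, wt N w d * ∑ e ∈ d, f e = ∑ e ∈ Efin N, wbar N w e * f e := by
  simp_rw [wbar, Finset.sum_mul, Finset.mul_sum]
  refine Finset.sum_comm' fun d e => ?_
  simp only [Efin, Finset.mem_filter, Finset.mem_univ, true_and]
  exact ⟨fun h => ⟨h, isEdge_of_mem_D h.1 h.2⟩, fun h => h.1⟩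

/-- The log-ratio of the two probabilities of an arborescence. -/
lemma log_prob_div_prob {N : ℕ} {w q : Edge N → ℝ}
    (hw : ∀ e, IsEdge N e → 0 < w e) (hq : ∀ e, IsEdge N e → 0 < q e)
    {d : Finset (Edge N)} (hd : d ∈ D N) :
    Real.log ((wt N w d / Z N w) / (wt N q d / Z N q))
      = ∑ e ∈ d, Real.log (w e / q e) + (Real.log (Z N q) - Real.log (Z N w)) := by
  have hD : (D N).Nonempty := ⟨d, hd⟩
  have hwd := (wt_pos hw hd).ne'
  have hqd := (wt_pos hq hd).ne'
  have hZw := (Z_pos hw hD).ne'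
  have hZq := (Z_pos hq hD).ne'
  have hsum : ∑ e ∈ d, Real.log (w e / q e) = Real.log (wt N w d) - Real.log (wt N q d) := by
    have hwe : ∀ e ∈ d, w e ≠ 0 := fun e he => (hw e (isEdge_of_mem_D hd he)).ne'
    have hqe : ∀ e ∈ d, q e ≠ 0 := fun e he => (hq e (isEdge_of_mem_D hd he)).ne'
    rw [wt, wt, Real.log_prod hwe, Real.log_prod hqe, ← Finset.sum_sub_distrib]
    exact Finset.sum_congr rfl fun e he => Real.log_div (hwe e he) (hqe e he)
  rw [hsum, Real.log_div (div_ne_zero hwd hZw) (div_ne_zero hqd hZq), Real.log_div hwd hZw,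
    Real.log_div hqd hZq]
  ring

/-- **Kullback–Leibler divergence as a first-order expectation**: if all edge weights
of `w` and `q` are positive and `D` is nonempty, then
`KL(p_w ∥ p_q) = Σ_d p_w(d) log(p_w(d)/p_q(d))
  = (1/Z(w)) Σ_{e∈E} w̄_e(w) log(w_e/q_e) − log Z(w) + log Z(q)`. -/
theorem kl_divergence (N : ℕ) (hN : 1 ≤ N) (w q : Edge N → ℝ)
    (hw : ∀ e : Edge N, IsEdge N e → 0 < w e)
    (hq : ∀ e : Edge N, IsEdge N e → 0 < q e) (hD : (D N).Nonempty) :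
    (∑ d ∈ D N, (wt N w d / Z N w) * Real.log ((wt N w d / Z N w) / (wt N q d / Z N q)))
      = (1 / Z N w) * (∑ e ∈ Efin N, wbar N w e * Real.log (w e / q e))
        - Real.log (Z N w) + Real.log (Z N q) := by
  have hZ := (Z_pos hw hD).ne'
  calc _ = ∑ d ∈ D N, (1 / Z N w * (wt N w d * ∑ e ∈ d, Real.log (w e / q e))
          + wt N w d * ((Real.log (Z N q) - Real.log (Z N w)) / Z N w)) :=
        Finset.sum_congr rfl fun d hd => by rw [log_prob_div_prob hw hq hd]; ring
    _ = 1 / Z N w * (∑ e ∈ Efin N, wbar N w e * Real.log (w e / q e))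
          + Z N w * ((Real.log (Z N q) - Real.log (Z N w)) / Z N w) := by
        rw [Finset.sum_add_distrib, ← Finset.mul_sum, ← Finset.sum_mul, sum_wt_mul_sum, ← Z]
    _ = _ := by
        rw [mul_div_cancel₀ _ hZ]
        ring
end
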